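/- Suppose 2 n_j < N_j for j = 1, …, d, where n_j := max{k_j : k ∈ Λ}, and let c ∈ ℭ_+(N) and P ∈ 𝔓̄_+(N) \ {0}. Then there exists Q̂ ∈ 𝔓̄_+(N) \ {0} minimizing the discrete dual functional J_P^N over 𝔓̄_+(N). Moreover, there exists a nonnegative function μ̂ on the grid {ζ_ℓ : ℓ ∈ ℤ^d_N} whose support is contained in {ζ_ℓ : Q̂(ζ_ℓ) = 0} and which can be chosen nonzero in at most |Λ|−1 points, such that c_k = (Π_{j=1}^d N_j)^{−1} Σ_{ℓ∈ℤ^d_N} ζ_ℓ^k (P(ζ_ℓ)/Q̂(ζ_ℓ) + μ̂(ζ_ℓ)) for all k ∈ Λ (with P(ζ_ℓ)/Q̂(ζ_ℓ) := 0 where P(ζ_ℓ) = 0). Finally, if P ∈ 𝔓_+(N), then Q̂ ∈ 𝔓_+(N), Q̂ is unique, and Φ = P/Q̂ satisfies the matching conditions with μ̂ ≡ 0. -/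

import Mathlib

open MeasureTheory Complex Set

noncomputable section

namespace RCE

/-- The scalar product (k,θ) = Σⱼ kⱼ θⱼ. -/
def dotP (d : ℕ) (k : Fin d → ℤ) (θ : Fin d → ℝ) : ℝ := ∑ j, (k j : ℝ) * θ j

/-- The d-dimensional torus 𝕋^d = (−π,π]^d. -/
def Td (d : ℕ) : Set (Fin d → ℝ) := Set.univ.pi fun _ => Set.Ioc (-Real.pi) Real.pi

/-- Normalized Lebesgue measure dm = (2π)^{-d} dθ on 𝕋^d. -/
def dm (d : ℕ) : Measure (Fin d → ℝ) :=
  (ENNReal.ofReal ((2 * Real.pi) ^ d))⁻¹ • (volume.restrict (Td d))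

/-- Conjugate-symmetric coefficient sequences supported on Λ. -/
def IsCoeff (d : ℕ) (Λ : Finset (Fin d → ℤ)) (p : (Fin d → ℤ) → ℂ) : Prop :=
  (∀ k, k ∉ Λ → p k = 0) ∧ ∀ k, p (-k) = starRingEnd ℂ (p k)

/-- Evaluation of the (real-valued) trigonometric polynomial
`P(e^{iθ}) = Σ_{k∈Λ} p_k e^{-i(k,θ)}`. -/
def eval (d : ℕ) (Λ : Finset (Fin d → ℤ)) (p : (Fin d → ℤ) → ℂ) (θ : Fin d → ℝ) : ℝ :=
  (∑ k ∈ Λ, p k * Complex.exp (-(dotP d k θ : ℂ) * Complex.I)).re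

/-- `𝔓̄₊` : the closed cone of nonnegative trigonometric polynomials. -/
def Pbar (d : ℕ) (Λ : Finset (Fin d → ℤ)) : Set ((Fin d → ℤ) → ℂ) :=
  {p | IsCoeff d Λ p ∧ ∀ θ ∈ Td d, 0 ≤ eval d Λ p θ}

/-- `𝔓₊` : the open cone of positive trigonometric polynomials. -/
def Pplus (d : ℕ) (Λ : Finset (Fin d → ℤ)) : Set ((Fin d → ℤ) → ℂ) :=
  {p | IsCoeff d Λ p ∧ ∀ θ ∈ Td d, 0 < eval d Λ p θ}

/-- The pairing ⟨c,p⟩ = Σ_{k∈Λ} c_k conj(p_k) (real-valued by conjugate symmetry). -/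
def pair (d : ℕ) (Λ : Finset (Fin d → ℤ)) (c p : (Fin d → ℤ) → ℂ) : ℝ :=
  (∑ k ∈ Λ, c k * starRingEnd ℂ (p k)).re

/-- `ℭ₊` : the interior of the dual cone. -/
def Cplus (d : ℕ) (Λ : Finset (Fin d → ℤ)) : Set ((Fin d → ℤ) → ℂ) :=
  {c | IsCoeff d Λ c ∧ ∀ p ∈ Pbar d Λ, p ≠ 0 → 0 < pair d Λ c p}

/-- `ℭ̄₊` : the closed dual cone. -/
def Cbar (d : ℕ) (Λ : Finset (Fin d → ℤ)) : Set ((Fin d → ℤ) → ℂ) :=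
  {c | IsCoeff d Λ c ∧ ∀ p ∈ Pbar d Λ, 0 ≤ pair d Λ c p}

/-- The dual functional J_P(Q) = ⟨c,q⟩ − ∫ P log Q dm. -/
def J (d : ℕ) (Λ : Finset (Fin d → ℤ)) (c P Q : (Fin d → ℤ) → ℂ) : ℝ :=
  pair d Λ c Q - ∫ θ, eval d Λ P θ * Real.log (eval d Λ Q θ) ∂(dm d)

/-- Covariance matching for an absolutely continuous measure Φ dm:
`c_k = ∫ e^{i(k,θ)} Φ(θ) dm(θ)` for all k ∈ Λ. -/
def Matches (d : ℕ) (Λ : Finset (Fin d → ℤ)) (c : (Fin d → ℤ) → ℂ)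
    (Φ : (Fin d → ℝ) → ℝ) : Prop :=
  ∀ k ∈ Λ, c k = ∫ θ, Complex.exp ((dotP d k θ : ℂ) * Complex.I) * (Φ θ : ℂ) ∂(dm d)

/-- The grid point θ_ℓ = (2π ℓ₁/N₁, …, 2π ℓ_d/N_d), so that ζ_ℓ = e^{iθ_ℓ}. -/
def gridθ (d : ℕ) (N : Fin d → ℕ) (L : (j : Fin d) → Fin (N j)) : Fin d → ℝ :=
  fun j => 2 * Real.pi * (L j : ℝ) / (N j : ℝ)

/-- Evaluation of the trigonometric polynomial at the grid point ζ_ℓ. -/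
def evalG (d : ℕ) (Λ : Finset (Fin d → ℤ)) (p : (Fin d → ℤ) → ℂ) (N : Fin d → ℕ)
    (L : (j : Fin d) → Fin (N j)) : ℝ :=
  eval d Λ p (gridθ d N L)

/-- `𝔓̄₊(N)` : polynomials nonnegative on the grid. -/
def PbarN (d : ℕ) (Λ : Finset (Fin d → ℤ)) (N : Fin d → ℕ) : Set ((Fin d → ℤ) → ℂ) :=
  {p | IsCoeff d Λ p ∧ ∀ L : (j : Fin d) → Fin (N j), 0 ≤ evalG d Λ p N L}

/-- `𝔓₊(N)` : polynomials positive on the grid. -/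
def PplusN (d : ℕ) (Λ : Finset (Fin d → ℤ)) (N : Fin d → ℕ) : Set ((Fin d → ℤ) → ℂ) :=
  {p | IsCoeff d Λ p ∧ ∀ L : (j : Fin d) → Fin (N j), 0 < evalG d Λ p N L}

/-- `ℭ₊(N)` : the interior of the dual cone of `𝔓̄₊(N)`. -/
def CplusN (d : ℕ) (Λ : Finset (Fin d → ℤ)) (N : Fin d → ℕ) : Set ((Fin d → ℤ) → ℂ) :=
  {c | IsCoeff d Λ c ∧ ∀ p ∈ PbarN d Λ N, p ≠ 0 → 0 < pair d Λ c p}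

/-- The discrete dual functional J_P^N(Q) = ⟨c,q⟩ − (Π_j N_j)⁻¹ Σ_ℓ P(ζ_ℓ) log Q(ζ_ℓ),
with the convention P(ζ_ℓ) log Q(ζ_ℓ) := 0 whenever P(ζ_ℓ) = 0. -/
def JN (d : ℕ) (Λ : Finset (Fin d → ℤ)) (N : Fin d → ℕ) (c P Q : (Fin d → ℤ) → ℂ) : ℝ :=
  pair d Λ c Q - (∏ j, (N j : ℝ))⁻¹ *
    ∑ L : (j : Fin d) → Fin (N j),
      (if evalG d Λ P N L = 0 then 0 else evalG d Λ P N L * Real.log (evalG d Λ Q N L))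

/-- The effective domain of J_P^N on `𝔓̄₊(N) \ {0}` : those Q for which the (extended-real
valued) functional J_P^N(Q) is finite, i.e. Q(ζ_ℓ) ≠ 0 whenever P(ζ_ℓ) ≠ 0.  Minimizing
J_P^N over `𝔓̄₊(N)` is the same as minimizing it over this set. -/
def domN (d : ℕ) (Λ : Finset (Fin d → ℤ)) (N : Fin d → ℕ) (P : (Fin d → ℤ) → ℂ) :
    Set ((Fin d → ℤ) → ℂ) :=
  {Q | Q ∈ PbarN d Λ N ∧ Q ≠ 0 ∧
    ∀ L : (j : Fin d) → Fin (N j), evalG d Λ P N L = 0 ∨ evalG d Λ Q N L ≠ 0}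

/-- **Farkas' lemma**, for finitely many linear functionals on an arbitrary real vector space. -/
theorem farkas {V ι : Type*} [AddCommGroup V] [Module ℝ V] (s : Finset ι)
    (A : ι → V →ₗ[ℝ] ℝ) (b : V →ₗ[ℝ] ℝ)
    (h : ∀ x, (∀ i ∈ s, 0 ≤ A i x) → 0 ≤ b x) :
    ∃ μ : ι → ℝ, (∀ i, 0 ≤ μ i) ∧ b = ∑ i ∈ s, μ i • A i := by
  classical
  induction s using Finset.induction_on generalizing A b with
  | empty =>
    refine ⟨0, fun _ => le_rfl, ?_⟩
    ext x
    have h1 := h x (by simp)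
    have h2 := h (-x) (by simp)
    rw [map_neg] at h2
    simp only [Finset.sum_empty, LinearMap.zero_apply]
    linarith
  | insert j t hj ih =>
    by_cases ht : ∀ x, (∀ i ∈ t, 0 ≤ A i x) → 0 ≤ b x
    · obtain ⟨μ, hμ, hb⟩ := ih A b ht
      refine ⟨Function.update μ j 0, fun i => ?_, ?_⟩
      · rcases eq_or_ne i j with rfl | hij
        · simp
        · simpa [hij] using hμ i
      · rw [Finset.sum_insert hj, hb]
        simp only [Function.update_self, zero_smul, zero_add]
        refine Finset.sum_congr rfl fun i hi => ?_
        rw [Function.update_of_ne (ne_of_mem_of_not_mem hi hj)]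
    · push Not at ht
      obtain ⟨z, hz, hbz⟩ := ht
      have hjz : A j z < 0 := by
        by_contra! hjz
        exact hbz.not_ge (h z (by simpa [hjz] using hz))
      obtain ⟨y, hy, hby, hjy⟩ :
          ∃ y, (∀ i ∈ t, 0 ≤ A i y) ∧ b y < 0 ∧ A j y = -1 := by
        have hpos : 0 < (-A j z)⁻¹ := inv_pos.2 (neg_pos.2 hjz)
        refine ⟨(-A j z)⁻¹ • z, fun i hi => ?_, ?_, ?_⟩
        · rw [map_smul, smul_eq_mul]
          exact mul_nonneg hpos.le (hz i hi)
        · rw [map_smul, smul_eq_mul]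
          exact mul_neg_of_pos_of_neg hpos hbz
        · rw [map_smul, smul_eq_mul, inv_neg, neg_mul, inv_mul_cancel₀ hjz.ne]
      obtain ⟨μ, hμ, hb⟩ := ih (fun i => A i + A i y • A j) (b + b y • A j) (by
        intro x hx
        have hx' := h (x + A j x • y) (by
          intro i hi
          rcases Finset.mem_insert.1 hi with rfl | hi
          · simp [hjy]
          · simpa [mul_comm] using hx i hi)
        simpa [mul_comm] using hx')
      refine ⟨Function.update μ j (∑ i ∈ t, μ i * A i y - b y), fun i => ?_, ?_⟩
      · rcases eq_or_ne i j with rfl | hij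
        · have := Finset.sum_nonneg fun i hi => mul_nonneg (hμ i) (hy i hi)
          simp only [Function.update_self]
          linarith
        · simpa [hij] using hμ i
      · have hsum : ∑ i ∈ t, Function.update μ j (∑ i ∈ t, μ i * A i y - b y) i • A i
            = ∑ i ∈ t, μ i • A i :=
          Finset.sum_congr rfl fun i hi => by
            rw [Function.update_of_ne (ne_of_mem_of_not_mem hi hj)]
        rw [Finset.sum_insert hj, hsum, Function.update_self]
        refine (eq_sub_of_add_eq hb).trans ?_
        ext x
        simp only [LinearMap.sub_apply, LinearMap.add_apply, LinearMap.smul_apply,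
          LinearMap.sum_apply, smul_eq_mul, mul_add, Finset.sum_add_distrib, sub_mul,
          Finset.sum_mul, mul_assoc]
        ring

/-- **Carathéodory's theorem** for cones: a conic combination of finitely many vectors is a conic
combination of a linearly independent subfamily. -/
theorem exists_linearIndepOn_conic {M ι : Type*} [AddCommGroup M] [Module ℝ M] (v : ι → M)
    (s : Finset ι) (μ : ι → ℝ) (hμ : ∀ i, 0 ≤ μ i) :
    ∃ t ⊆ s, LinearIndepOn ℝ v (t : Set ι) ∧ ∃ ν : ι → ℝ, (∀ i, 0 ≤ ν i) ∧
      ∑ i ∈ s, μ i • v i = ∑ i ∈ t, ν i • v i := by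
  classical
  induction s using Finset.strongInduction generalizing μ with
  | H s ih =>
    by_cases hs : LinearIndepOn ℝ v (s : Set ι)
    · exact ⟨s, subset_rfl, hs, μ, hμ, rfl⟩
    obtain ⟨g, hg, hpos⟩ : ∃ g : ι → ℝ, ∑ i ∈ s, g i • v i = 0 ∧ ∃ i ∈ s, 0 < g i := by
      obtain ⟨g, hg, i, hi, hgi⟩ := not_linearIndepOn_finset_iff.1 hs
      rcases hgi.lt_or_gt with hgi | hgi
      · exact ⟨-g, by simp [hg], i, hi, by simpa using hgi⟩
      · exact ⟨g, hg, i, hi, hgi⟩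
    obtain ⟨j, hj, hmin⟩ := ({i ∈ s | 0 < g i} : Finset ι).exists_min_image
      (fun i => μ i / g i) (by
        obtain ⟨i, hi, hgi⟩ := hpos
        exact ⟨i, Finset.mem_filter.2 ⟨hi, hgi⟩⟩)
    obtain ⟨hjs, hgj⟩ := Finset.mem_filter.1 hj
    have hnonneg : ∀ i ∈ s, 0 ≤ μ i - μ j / g j * g i := by
      intro i hi
      rcases le_or_gt (g i) 0 with hgi | hgi
      · have := mul_nonpos_of_nonneg_of_nonpos (div_nonneg (hμ j) hgj.le) hgi
        linarith [hμ i]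
      · have := hmin i (Finset.mem_filter.2 ⟨hi, hgi⟩)
        rw [le_div_iff₀ hgi] at this
        linarith
    obtain ⟨t, hts, hli, ν, hν, hsum⟩ := ih (s.erase j) (Finset.erase_ssubset hjs)
      (fun i => max (μ i - μ j / g j * g i) 0) (fun i => le_max_right _ _)
    refine ⟨t, hts.trans (Finset.erase_subset _ _), hli, ν, hν, ?_⟩
    rw [← hsum]
    calc ∑ i ∈ s, μ i • v i
        = ∑ i ∈ s, (μ i - μ j / g j * g i) • v i := by
          simp only [sub_smul, Finset.sum_sub_distrib, mul_smul, ← Finset.smul_sum, hg, smul_zero,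
            sub_zero]
      _ = ∑ i ∈ s.erase j, (μ i - μ j / g j * g i) • v i := by
          refine (Finset.sum_erase _ ?_).symm
          rw [div_mul_cancel₀ _ hgj.ne', sub_self, zero_smul]
      _ = _ := Finset.sum_congr rfl fun i hi => by
          rw [max_eq_left (hnonneg i (Finset.mem_of_mem_erase hi))]

/-- Linearly independent functionals with a common nonzero zero are fewer than the dimension. -/
theorem card_lt_finrank_of_apply_eq_zero {V ι : Type*} [AddCommGroup V] [Module ℝ V]
    [FiniteDimensional ℝ V] (A : ι → V →ₗ[ℝ] ℝ) (t : Finset ι)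
    (hli : LinearIndepOn ℝ A (t : Set ι)) {v : V} (hv : v ≠ 0) (h : ∀ i ∈ t, A i v = 0) :
    t.card < Module.finrank ℝ V := by
  have hlt : Submodule.span ℝ (A '' (t : Set ι)) < ⊤ := by
    refine lt_top_iff_ne_top.2 fun htop => hv ?_
    refine (Module.forall_dual_apply_eq_zero_iff ℝ v).1 fun f => ?_
    have hf : f ∈ Submodule.span ℝ (A '' (t : Set ι)) := htop ▸ Submodule.mem_top
    refine Submodule.span_induction ?_ ?_ ?_ ?_ hf
    · rintro _ ⟨i, hi, rfl⟩
      exact h i hi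
    · rfl
    · intro f g _ _ hf hg
      simp [hf, hg]
    · intro a f _ hf
      simp [hf]
  have h1 := Submodule.finrank_lt_finrank_of_lt hlt
  rw [finrank_top, Subspace.dual_finrank_eq] at h1
  have h2 := finrank_span_eq_card (R := ℝ) hli
  rw [← image_eq_range] at h2
  simpa [h2] using h1

section Barrier

variable {V ι : Type*} [AddCommGroup V] [Module ℝ V] [Fintype ι]

/-- A functional that is positive on a closed pointed cone is coercive on it. -/
theorem exists_mul_norm_le (E : V →ₗ[ℝ] ι → ℝ) (c : (ι → ℝ) →ₗ[ℝ] ℝ)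
    (hc : ∀ v, 0 ≤ E v → E v ≠ 0 → 0 < c (E v)) :
    ∃ ε > 0, ∀ v, 0 ≤ E v → ε * ‖E v‖ ≤ c (E v) := by
  have hcomp : IsCompact (Metric.sphere (0 : ι → ℝ) 1 ∩ (range E ∩ {y | 0 ≤ y})) :=
    (isCompact_sphere _ _).inter_right
      ((LinearMap.coe_range E ▸ Submodule.closed_of_finiteDimensional (LinearMap.range E)).inter
        isClosed_Ici)
  obtain ⟨ε, hε, hle⟩ := hcomp.exists_forall_le' (f := c) (a := 0)
    (LinearMap.continuous_of_finiteDimensional c).continuousOn (by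
      rintro _ ⟨h1, ⟨v, rfl⟩, h3⟩
      refine hc v h3 fun h => ?_
      simp [h] at h1)
  refine ⟨ε, hε, fun v hv => ?_⟩
  rcases eq_or_ne (E v) 0 with h | h
  · simp [h]
  have hn : 0 < ‖E v‖ := norm_pos_iff.2 h
  have := hle (‖E v‖⁻¹ • E v) ⟨by simp [norm_smul, hn.ne'], ⟨‖E v‖⁻¹ • v, by simp⟩,
    smul_nonneg (inv_nonneg.2 hn.le) hv⟩
  rw [map_smul, smul_eq_mul, inv_mul_eq_div, le_div_iff₀ hn] at this
  exact this

/-- The weighted logarithmic barrier functional on a polyhedral cone has a minimizer. -/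
theorem exists_barrier_minimizer (E : V →ₗ[ℝ] ι → ℝ) (hE : Function.Injective E)
    (c : V →ₗ[ℝ] ℝ) (hc : ∀ v, 0 ≤ E v → v ≠ 0 → 0 < c v) (p : ι → ℝ) (hp : 0 ≤ p)
    (v₀ : V) (hv₀ : ∀ i, 0 < E v₀ i) :
    ∃ v, 0 ≤ E v ∧ (∀ i, p i = 0 ∨ E v i ≠ 0) ∧
      ∀ w, 0 ≤ E w → (∀ i, p i = 0 ∨ E w i ≠ 0) →
        c v - ∑ i, p i * Real.log (E v i) ≤ c w - ∑ i, p i * Real.log (E w i) := by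
  obtain ⟨g, hg⟩ := LinearMap.exists_leftInverse_of_injective E (LinearMap.ker_eq_bot.2 hE)
  have hgE : ∀ v, g (E v) = v := fun v => LinearMap.congr_fun hg v
  set c' : (ι → ℝ) →ₗ[ℝ] ℝ := c ∘ₗ g
  have hc'E : ∀ v, c' (E v) = c v := fun v => by simp [c', hgE]
  obtain ⟨ε, hε, hle⟩ := exists_mul_norm_le E c' (fun v hv hv' => by
    rw [hc'E]
    exact hc v hv fun h => hv' (by simp [h]))
  set G : (ι → ℝ) → ℝ := fun y => Real.exp (-c' y) * ∏ i, y i ^ p i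
  have hGcont : Continuous G :=
    (Real.continuous_exp.comp (LinearMap.continuous_of_finiteDimensional c').neg).mul
      (continuous_finsetProd _ fun i _ =>
        (Real.continuous_rpow_const (hp i)).comp (continuous_apply i))
  have hGexp : ∀ w, 0 ≤ E w → (∀ i, p i = 0 ∨ E w i ≠ 0) →
      G (E w) = Real.exp (-(c w - ∑ i, p i * Real.log (E w i))) := by
    intro w hw hpw
    simp only [G, hc'E]
    rw [neg_sub, sub_eq_neg_add, Real.exp_add, Real.exp_sum]
    congr 1
    refine Finset.prod_congr rfl fun i _ => ?_
    rcases hpw i with h | h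
    · simp [h]
    · rw [Real.rpow_def_of_pos (lt_of_le_of_ne (hw i) h.symm), mul_comm]
  have hclosed : IsClosed (range E ∩ {y | 0 ≤ y}) :=
    (LinearMap.coe_range E ▸ Submodule.closed_of_finiteDimensional (LinearMap.range E)).inter
      isClosed_Ici
  have hG₀ : 0 < G (E v₀) :=
    mul_pos (Real.exp_pos _) (Finset.prod_pos fun i _ => Real.rpow_pos_of_pos (hv₀ i) _)
  have hbound : ∀ y ∈ range E ∩ {y | 0 ≤ y},
      G y ≤ ‖y‖ ^ (∑ i, p i) * Real.exp (-ε * ‖y‖) := by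
    rintro _ ⟨⟨v, rfl⟩, hv⟩
    rw [mul_comm, Real.rpow_sum_of_nonneg (norm_nonneg _) fun i _ => hp i]
    simp only [G]
    rw [mul_comm (Real.exp _), mul_comm (Real.exp _)]
    refine mul_le_mul (Finset.prod_le_prod (fun i _ => Real.rpow_nonneg (hv i) _) fun i _ =>
      Real.rpow_le_rpow (hv i) ((le_abs_self _).trans (norm_le_pi_norm (E v) i)) (hp i))
      (Real.exp_le_exp.2 ?_) (Real.exp_pos _).le
      (Finset.prod_nonneg fun i _ => Real.rpow_nonneg (norm_nonneg _) _)
    have := hle v hv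
    linarith
  have hev : ∀ᶠ y in Filter.cocompact (ι → ℝ) ⊓ Filter.principal (range E ∩ {y | 0 ≤ y}),
      G y ≤ G (E v₀) := by
    have := ((tendsto_rpow_mul_exp_neg_mul_atTop_nhds_zero (∑ i, p i) ε hε).comp
      (tendsto_norm_cocompact_atTop (E := ι → ℝ))).eventually_le_const hG₀
    rw [Filter.eventually_inf_principal]
    filter_upwards [this] with y hy hyK
    exact (hbound y hyK).trans hy
  obtain ⟨_, ⟨⟨v, rfl⟩, hv⟩, hmax⟩ := hGcont.continuousOn.exists_isMaxOn' hclosed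
    (⟨⟨v₀, rfl⟩, fun i => (hv₀ i).le⟩ : E v₀ ∈ range E ∩ {y | 0 ≤ y}) hev
  have hGv : 0 < G (E v) :=
    hG₀.trans_le (hmax (⟨⟨v₀, rfl⟩, fun i => (hv₀ i).le⟩ : E v₀ ∈ range E ∩ {y | 0 ≤ y}))
  have hpv : ∀ i, p i = 0 ∨ E v i ≠ 0 := by
    intro i
    by_contra! h
    refine hGv.ne' (mul_eq_zero_of_right _ (Finset.prod_eq_zero (Finset.mem_univ i) ?_))
    rw [h.2, Real.zero_rpow h.1]
  refine ⟨v, hv, hpv, fun w hw hpw => ?_⟩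
  have := hmax (⟨⟨w, rfl⟩, hw⟩ : E w ∈ range E ∩ {y | 0 ≤ y})
  simp only [mem_ofPred_eq, hGexp w hw hpw, hGexp v hv hpv, Real.exp_le_exp] at this
  linarith

/-- First-order condition at a minimizer of the logarithmic barrier functional: the derivative is
nonnegative in every direction pointing into the cone. -/
theorem barrier_first_order (E : V →ₗ[ℝ] ι → ℝ) (c : V →ₗ[ℝ] ℝ) (p : ι → ℝ) (hp : 0 ≤ p)
    (v : V) (hv : 0 ≤ E v) (hpv : ∀ i, p i = 0 ∨ E v i ≠ 0)
    (hmin : ∀ w, 0 ≤ E w → (∀ i, p i = 0 ∨ E w i ≠ 0) →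
      c v - ∑ i, p i * Real.log (E v i) ≤ c w - ∑ i, p i * Real.log (E w i))
    (z : V) (hz : ∀ i, E v i = 0 → 0 ≤ E z i) :
    0 ≤ c z - ∑ i, p i / E v i * E z i := by
  have hnear : ∀ i, ∀ᶠ t : ℝ in nhdsWithin 0 (Ioi 0),
      0 ≤ E v i + t * E z i ∧ (E v i ≠ 0 → 0 < E v i + t * E z i) := by
    intro i
    rcases eq_or_ne (E v i) 0 with h | h
    · filter_upwards [self_mem_nhdsWithin] with t ht
      exact ⟨by simpa [h] using mul_nonneg (mem_Ioi.1 ht).le (hz i h), fun h' => absurd h h'⟩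
    · have hpos : 0 < E v i := lt_of_le_of_ne (hv i) h.symm
      have hcont : Filter.Tendsto (fun t : ℝ => E v i + t * E z i) (nhdsWithin 0 (Ioi 0))
          (nhds (E v i)) := by
        have : Continuous fun t : ℝ => E v i + t * E z i := by fun_prop
        simpa using (this.tendsto 0).mono_left nhdsWithin_le_nhds
      filter_upwards [hcont.eventually_const_lt hpos] with t ht
      exact ⟨ht.le, fun _ => ht⟩
  have hlim : Filter.Tendsto (fun t : ℝ => c z - ∑ i, p i / (E v i + t * E z i) * E z i)
      (nhdsWithin 0 (Ioi 0)) (nhds (c z - ∑ i, p i / E v i * E z i)) := by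
    refine tendsto_const_nhds.sub (tendsto_finsetSum _ fun i _ => ?_)
    rcases hpv i with h | h
    · simp [h]
    · have : ContinuousAt (fun t : ℝ => p i / (E v i + t * E z i) * E z i) 0 := by
        fun_prop (disch := simpa using h)
      simpa using this.tendsto.mono_left nhdsWithin_le_nhds
  refine ge_of_tendsto hlim ?_
  filter_upwards [self_mem_nhdsWithin, Filter.eventually_all.2 hnear] with t ht hall
  have ht : 0 < t := ht
  have hEw : ∀ i, E (v + t • z) i = E v i + t * E z i := fun i => by simp
  have hm := hmin (v + t • z) (fun i => by simpa using (hall i).1) (fun i =>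
    (hpv i).imp id fun h => by simpa using ((hall i).2 h).ne')
  have hterm : ∀ i, p i * Real.log (E v i) - p i * Real.log (E (v + t • z) i)
      ≤ -(t * (p i / (E v i + t * E z i) * E z i)) := by
    intro i
    rw [hEw]
    rcases hpv i with h | h
    · simp [h]
    · have h1 : 0 < E v i := lt_of_le_of_ne (hv i) h.symm
      have h2 := (hall i).2 h
      have h3 := Real.log_le_sub_one_of_pos (div_pos h1 h2)
      rw [Real.log_div h1.ne' h2.ne'] at h3
      calc _ = p i * (Real.log (E v i) - Real.log (E v i + t * E z i)) := by ring
        _ ≤ p i * (E v i / (E v i + t * E z i) - 1) := mul_le_mul_of_nonneg_left h3 (hp i)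
        _ = _ := by
          field_simp
          ring
  have hsum := Finset.sum_le_sum fun i (_ : i ∈ Finset.univ) => hterm i
  rw [Finset.sum_sub_distrib, Finset.sum_neg_distrib, ← Finset.mul_sum] at hsum
  rw [map_add, map_smul, smul_eq_mul] at hm
  have : 0 ≤ t * (c z - ∑ i, p i / (E v i + t * E z i) * E z i) := by
    rw [mul_sub]
    linarith
  exact nonneg_of_mul_nonneg_right this ht

/-- Karush–Kuhn–Tucker representation at a minimizer of the logarithmic barrier functional, with
a multiplier of small support. -/
theorem exists_barrier_multiplier (E : V →ₗ[ℝ] ι → ℝ) (hE : Function.Injective E)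
    (c : V →ₗ[ℝ] ℝ) (p : ι → ℝ) (hp : 0 ≤ p)
    (v : V) (hv0 : v ≠ 0) (hv : 0 ≤ E v) (hpv : ∀ i, p i = 0 ∨ E v i ≠ 0)
    (hmin : ∀ w, 0 ≤ E w → (∀ i, p i = 0 ∨ E w i ≠ 0) →
      c v - ∑ i, p i * Real.log (E v i) ≤ c w - ∑ i, p i * Real.log (E w i)) :
    ∃ μ : ι → ℝ, (∀ i, 0 ≤ μ i) ∧ (∀ i, μ i ≠ 0 → E v i = 0) ∧
      (∃ S : Finset ι, S.card < Module.finrank ℝ V ∧ ∀ i ∉ S, μ i = 0) ∧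
      ∀ z, c z = ∑ i, (p i / E v i + μ i) * E z i := by
  classical
  have : FiniteDimensional ℝ V := FiniteDimensional.of_injective E hE
  set A : ι → V →ₗ[ℝ] ℝ := fun i => LinearMap.proj i ∘ₗ E
  obtain ⟨μ, hμ, hrep⟩ := farkas ({i | E v i = 0} : Finset ι) A
    (c - ∑ i, (p i / E v i) • A i) (fun z hz => by
      simpa [A, LinearMap.sum_apply] using barrier_first_order E c p hp v hv hpv hmin z
        (fun i hi => hz i (by simpa using hi)))
  obtain ⟨t, ht, hli, ν, hν, hsum⟩ := exists_linearIndepOn_conic A {i | E v i = 0} μ hμ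
  have htz : ∀ i ∈ t, E v i = 0 := fun i hi => (Finset.mem_filter.1 (ht hi)).2
  refine ⟨fun i => if i ∈ t then ν i else 0, fun i => ?_, fun i hi => ?_, ⟨t, ?_, ?_⟩, fun z => ?_⟩
  · dsimp only
    split_ifs
    exacts [hν i, le_rfl]
  · exact htz i (by_contra fun h => hi (if_neg h))
  · exact card_lt_finrank_of_apply_eq_zero A t hli hv0 htz
  · exact fun i hi => if_neg hi
  · have hz := LinearMap.congr_fun (sub_eq_iff_eq_add.1 (hrep.trans hsum)) z
    rw [hz]
    simp [A, LinearMap.sum_apply, add_mul, Finset.sum_add_distrib, ite_mul, add_comm]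

end Barrier
section TrigPoly

variable {d : ℕ} {Λ : Finset (Fin d → ℤ)} {N : Fin d → ℕ}

/-- The real vector space of coefficient sequences of trigonometric polynomials. -/
def coeffs (d : ℕ) (Λ : Finset (Fin d → ℤ)) : Submodule ℝ ((Fin d → ℤ) → ℂ) where
  carrier := {p | IsCoeff d Λ p}
  zero_mem' := ⟨fun _ _ => rfl, fun _ => by simp⟩
  add_mem' := fun {p q} hp hq =>
    ⟨fun k hk => by simp [hp.1 k hk, hq.1 k hk], fun k => by simp [hp.2 k, hq.2 k]⟩
  smul_mem' := fun a p hp => ⟨fun k hk => by simp [hp.1 k hk], fun k => by simp [hp.2 k]⟩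

/-- Evaluation on the grid, as a linear map. -/
def gridEval (d : ℕ) (Λ : Finset (Fin d → ℤ)) (N : Fin d → ℕ) :
    coeffs d Λ →ₗ[ℝ] ((j : Fin d) → Fin (N j)) → ℝ where
  toFun p L := evalG d Λ p N L
  map_add' p q := by
    ext L
    simp [evalG, eval, add_mul, Finset.sum_add_distrib]
  map_smul' a p := by
    ext L
    simp [evalG, eval, mul_assoc, ← Finset.mul_sum]

/-- The pairing with a fixed coefficient sequence, as a linear functional. -/
def pairing (d : ℕ) (Λ : Finset (Fin d → ℤ)) (c : (Fin d → ℤ) → ℂ) : coeffs d Λ →ₗ[ℝ] ℝ where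
  toFun p := pair d Λ c p
  map_add' p q := by
    simp [pair, mul_add, Finset.sum_add_distrib]
  map_smul' a p := by
    simp only [pair, Complex.re_sum, Finset.mul_sum, RingHom.id_apply, smul_eq_mul]
    refine Finset.sum_congr rfl fun k _ => ?_
    simp
    ring

/-- The real and imaginary parts of a conjugate-symmetric sequence can be recovered from their
sum, so the space of coefficient sequences has real dimension at most `|Λ|`. -/
theorem finrank_coeffs_le (hΛ : ∀ k ∈ Λ, -k ∈ Λ) : Module.finrank ℝ (coeffs d Λ) ≤ Λ.card := by
  let T : coeffs d Λ →ₗ[ℝ] Λ → ℝ :=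
    { toFun := fun p k => (p.1 k).re + (p.1 k).im
      map_add' := fun p q => by
        ext k
        simp
        ring
      map_smul' := fun a p => by
        ext k
        simp
        ring }
  have hT : Function.Injective T := by
    rw [injective_iff_map_eq_zero]
    intro p hp
    ext k
    by_cases hk : k ∈ Λ
    · have h1 : (p.1 k).re + (p.1 k).im = 0 := congrFun hp ⟨k, hk⟩
      have h2 : (p.1 (-k)).re + (p.1 (-k)).im = 0 := congrFun hp ⟨-k, hΛ k hk⟩
      rw [p.2.2 k, Complex.conj_re, Complex.conj_im] at h2
      apply Complex.ext <;> simp <;> linarith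
    · exact p.2.1 k hk
  simpa using LinearMap.finrank_le_finrank_of_injective hT

theorem dotP_sub (k l : Fin d → ℤ) (θ : Fin d → ℝ) :
    dotP d (k - l) θ = dotP d k θ - dotP d l θ := by
  simp [dotP, sub_mul]

theorem dotP_neg (k : Fin d → ℤ) (θ : Fin d → ℝ) : dotP d (-k) θ = -dotP d k θ := by
  simp [dotP]

/-- Orthogonality of characters on the grid. -/
theorem sum_grid_exp_eq_zero (k : Fin d → ℤ) (hk0 : k ≠ 0) (hk : ∀ j, |k j| < N j) :
    ∑ L : (j : Fin d) → Fin (N j), Complex.exp ((dotP d k (gridθ d N L) : ℂ) * Complex.I) = 0 := by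
  obtain ⟨j, hj⟩ := Function.ne_iff.1 hk0
  set w : Fin d → ℂ := fun j => Complex.exp (2 * Real.pi * Complex.I * (k j / N j))
  have hterm : ∀ L : (j : Fin d) → Fin (N j),
      Complex.exp ((dotP d k (gridθ d N L) : ℂ) * Complex.I) = ∏ j, w j ^ (L j : ℕ) := by
    intro L
    simp only [w, ← Complex.exp_nat_mul, ← Complex.exp_sum]
    congr 1
    simp only [dotP, gridθ, Complex.ofReal_sum, Finset.sum_mul]
    refine Finset.sum_congr rfl fun j _ => ?_
    push_cast
    ring
  have hNj : (N j : ℂ) ≠ 0 := by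
    have := (abs_nonneg _).trans_lt (hk j)
    exact_mod_cast this.ne'
  have hpi : (2 * Real.pi * Complex.I : ℂ) ≠ 0 := Complex.two_pi_I_ne_zero
  have hw1 : w j ≠ 1 := by
    intro h
    obtain ⟨n, hn⟩ := Complex.exp_eq_one_iff.1 h
    rw [mul_comm (n : ℂ)] at hn
    have h2 := mul_left_cancel₀ hpi hn
    rw [div_eq_iff hNj] at h2
    have h3 : k j = n * N j := by exact_mod_cast h2
    exact hj (Int.eq_zero_of_abs_lt_dvd ⟨n, by rw [h3, mul_comm]⟩ (hk j))
  have hwN : w j ^ N j = 1 := by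
    simp only [w]
    rw [← Complex.exp_nat_mul, Complex.exp_eq_one_iff]
    refine ⟨k j, ?_⟩
    field_simp
  have hgeom : ∑ l : Fin (N j), w j ^ (l : ℕ) = 0 := by
    rw [Fin.sum_univ_eq_sum_range (fun l => w j ^ l), geom_sum_eq hw1, hwN, sub_self, zero_div]
  simp only [hterm]
  have := Finset.prod_univ_sum (fun j => (Finset.univ : Finset (Fin (N j))))
    (fun j l => w j ^ (l : ℕ))
  rw [Fintype.piFinset_univ] at this
  rw [← this]
  exact Finset.prod_eq_zero (Finset.mem_univ j) hgeom

theorem sum_grid_exp_zero :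
    ∑ L : (j : Fin d) → Fin (N j), Complex.exp ((dotP d 0 (gridθ d N L) : ℂ) * Complex.I)
      = ∏ j, (N j : ℂ) := by
  simp [dotP]

/-- A trigonometric polynomial with conjugate-symmetric coefficients is real-valued. -/
theorem ofReal_eval (hΛ : ∀ k ∈ Λ, -k ∈ Λ) {p : (Fin d → ℤ) → ℂ} (hp : IsCoeff d Λ p)
    (θ : Fin d → ℝ) :
    (eval d Λ p θ : ℂ) = ∑ k ∈ Λ, p k * Complex.exp (-(dotP d k θ : ℂ) * Complex.I) := by
  refine Complex.conj_eq_iff_re.1 ?_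
  rw [map_sum]
  refine Finset.sum_bij' (fun k _ => -k) (fun k _ => -k) hΛ hΛ (by simp) (by simp) fun k _ => ?_
  rw [hp.2 k, dotP_neg, map_mul, ← Complex.exp_conj]
  simp

theorem abs_lt_of_two_mul_lt (hΛ : ∀ k ∈ Λ, -k ∈ Λ) (hN : ∀ k ∈ Λ, ∀ j, 2 * k j < (N j : ℤ))
    {k l : Fin d → ℤ} (hk : k ∈ Λ) (hl : l ∈ Λ) (j : Fin d) : |(k - l) j| < N j := by
  have h1 := hN k hk j
  have h2 := hN l hl j
  have h3 := hN _ (hΛ k hk) j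
  have h4 := hN _ (hΛ l hl) j
  simp only [Pi.neg_apply] at h3 h4
  rw [Pi.sub_apply, abs_lt]
  omega

theorem gridEval_injective (h0 : (0 : Fin d → ℤ) ∈ Λ) (hΛ : ∀ k ∈ Λ, -k ∈ Λ)
    (hN : ∀ k ∈ Λ, ∀ j, 2 * k j < (N j : ℤ)) : Function.Injective (gridEval d Λ N) := by
  rw [injective_iff_map_eq_zero]
  intro p hp
  ext l
  by_cases hl : l ∈ Λ
  swap
  · exact p.2.1 l hl
  have hNpos : ∏ j, (N j : ℂ) ≠ 0 := Finset.prod_ne_zero_iff.2 fun j _ => by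
    have := hN 0 h0 j
    simp only [Pi.zero_apply] at this
    exact_mod_cast (show N j ≠ 0 by omega)
  have hzero : ∀ L, ∑ k ∈ Λ, p.1 k * Complex.exp (-(dotP d k (gridθ d N L) : ℂ) * Complex.I)
      = 0 := by
    intro L
    rw [← ofReal_eval hΛ p.2]
    exact_mod_cast congrFun hp L
  have key : p.1 l * ∏ j, (N j : ℂ) = 0 := by
    calc p.1 l * ∏ j, (N j : ℂ)
        = ∑ k ∈ Λ, p.1 k * ∑ L : (j : Fin d) → Fin (N j),
            Complex.exp ((dotP d (l - k) (gridθ d N L) : ℂ) * Complex.I) := by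
          rw [Finset.sum_eq_single_of_mem l hl, sub_self, sum_grid_exp_zero]
          intro k hk hkl
          rw [sum_grid_exp_eq_zero (l - k) (sub_ne_zero.2 hkl.symm)
            (abs_lt_of_two_mul_lt hΛ hN hl hk), mul_zero]
      _ = ∑ L : (j : Fin d) → Fin (N j),
            Complex.exp ((dotP d l (gridθ d N L) : ℂ) * Complex.I) *
              ∑ k ∈ Λ, p.1 k * Complex.exp (-(dotP d k (gridθ d N L) : ℂ) * Complex.I) := by
          simp only [Finset.mul_sum]
          rw [Finset.sum_comm]
          refine Finset.sum_congr rfl fun L _ => Finset.sum_congr rfl fun k _ => ?_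
          rw [mul_left_comm, ← Complex.exp_add, dotP_sub]
          push_cast
          ring_nf
      _ = 0 := by simp only [hzero, mul_zero, Finset.sum_const_zero]
  simpa [hNpos] using key

/-- A sequence is determined by the functional it represents: if pairing with `c` is integration
on the grid against `Φ`, then `c` is the sequence of Fourier coefficients of `Φ`. -/
theorem eq_sum_grid_of_pair_eq (hΛ : ∀ k ∈ Λ, -k ∈ Λ) {c : (Fin d → ℤ) → ℂ}
    (hc : IsCoeff d Λ c) (Φ : ((j : Fin d) → Fin (N j)) → ℝ)
    (h : ∀ q, IsCoeff d Λ q → pair d Λ c q = (∏ j, (N j : ℝ))⁻¹ * ∑ L, Φ L * evalG d Λ q N L)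
    (k : Fin d → ℤ) (hk : k ∈ Λ) :
    c k = (∏ j, (N j : ℂ))⁻¹ * ∑ L : (j : Fin d) → Fin (N j),
      Complex.exp ((dotP d k (gridθ d N L) : ℂ) * Complex.I) * (Φ L : ℂ) := by
  classical
  set b : (Fin d → ℤ) → ℂ := fun k => (∏ j, (N j : ℂ))⁻¹ * ∑ L : (j : Fin d) → Fin (N j),
      Complex.exp ((dotP d k (gridθ d N L) : ℂ) * Complex.I) * (Φ L : ℂ) with hb
  have hbneg : ∀ k, b (-k) = starRingEnd ℂ (b k) := by
    intro k
    simp only [hb, map_mul, map_sum, map_inv₀, map_prod, ← Complex.exp_conj, dotP_neg]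
    simp
  have hpair : ∀ q, IsCoeff d Λ q → ∑ k ∈ Λ, b k * starRingEnd ℂ (q k)
      = (((∏ j, (N j : ℝ))⁻¹ * ∑ L, Φ L * evalG d Λ q N L : ℝ) : ℂ) := by
    intro q hq
    have hconj : ∀ L, ((evalG d Λ q N L : ℝ) : ℂ)
        = ∑ k ∈ Λ, starRingEnd ℂ (q k) *
          Complex.exp ((dotP d k (gridθ d N L) : ℂ) * Complex.I) := by
      intro L
      rw [evalG, ← Complex.conj_ofReal, ofReal_eval hΛ hq, map_sum]
      refine Finset.sum_congr rfl fun k _ => ?_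
      rw [map_mul, ← Complex.exp_conj]
      simp
    push_cast
    simp only [hconj, hb, Finset.mul_sum, Finset.sum_mul]
    rw [Finset.sum_comm]
    refine Finset.sum_congr rfl fun L _ => Finset.sum_congr rfl fun k _ => ?_
    ring
  set r : (Fin d → ℤ) → ℂ := fun k => if k ∈ Λ then c k - b k else 0 with hr
  have hmem : ∀ k, -k ∈ Λ ↔ k ∈ Λ := fun k => ⟨fun h => by simpa using hΛ _ h, hΛ k⟩
  have hrc : IsCoeff d Λ r := by
    refine ⟨fun k hk => if_neg hk, fun k => ?_⟩
    simp only [hr, hmem]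
    split_ifs
    · rw [map_sub, hc.2, hbneg]
    · simp
  have hzero : ∑ k ∈ Λ, Complex.normSq (r k) = 0 := by
    have h1 := h r hrc
    have h2 := congrArg Complex.re (hpair r hrc)
    rw [Complex.ofReal_re, ← h1, pair, eq_comm, ← sub_eq_zero, ← Complex.sub_re,
      ← Finset.sum_sub_distrib, Complex.re_sum] at h2
    rw [← h2]
    refine Finset.sum_congr rfl fun k hk => ?_
    rw [← sub_mul, show c k - b k = r k by simp [hr, hk], Complex.mul_conj, Complex.ofReal_re]
  have hrk := (Finset.sum_eq_zero_iff_of_nonneg fun k _ => Complex.normSq_nonneg _).1 hzero k hk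
  rw [Complex.normSq_eq_zero] at hrk
  simp only [hr, hk, if_true] at hrk
  exact sub_eq_zero.1 hrk

theorem JN_eq (c P Q : (Fin d → ℤ) → ℂ) :
    JN d Λ N c P Q = pair d Λ c Q -
      ∑ L, ((∏ j, (N j : ℝ))⁻¹ * evalG d Λ P N L) * Real.log (evalG d Λ Q N L) := by
  simp only [JN, Finset.mul_sum]
  congr 1
  refine Finset.sum_congr rfl fun L _ => ?_
  split_ifs with h <;> simp [h, mul_assoc]

theorem prod_grid_pos (h0 : (0 : Fin d → ℤ) ∈ Λ) (hN : ∀ k ∈ Λ, ∀ j, 2 * k j < (N j : ℤ)) :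
    0 < ∏ j, (N j : ℝ) :=
  Finset.prod_pos fun j _ => by
    have := hN 0 h0 j
    simp only [Pi.zero_apply] at this
    exact_mod_cast (show 0 < N j by omega)

theorem isCoeff_one (h0 : (0 : Fin d → ℤ) ∈ Λ) : IsCoeff d Λ (Pi.single 0 1) := by
  classical
  refine ⟨fun k hk => Pi.single_eq_of_ne (by rintro rfl; exact hk h0) _, fun k => ?_⟩
  by_cases hk : k = 0
  · simp [hk]
  · simp [hk]

theorem evalG_one (h0 : (0 : Fin d → ℤ) ∈ Λ) (L : (j : Fin d) → Fin (N j)) :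
    evalG d Λ (Pi.single 0 1) N L = 1 := by
  classical
  rw [evalG, eval, Finset.sum_eq_single_of_mem 0 h0]
  · simp [dotP]
  · intro k _ hk
    simp [hk]

/-- The nonvanishing condition `Q ≠ 0` in the effective domain is automatic when `P ≠ 0`. -/
theorem mem_domN_of_isCoeff (h0 : (0 : Fin d → ℤ) ∈ Λ) (hΛ : ∀ k ∈ Λ, -k ∈ Λ)
    (hN : ∀ k ∈ Λ, ∀ j, 2 * k j < (N j : ℤ)) {P Q : (Fin d → ℤ) → ℂ} (hP : IsCoeff d Λ P)
    (hP0 : P ≠ 0) (hQ : IsCoeff d Λ Q) (hQ0 : ∀ L, 0 ≤ evalG d Λ Q N L)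
    (hPQ : ∀ L, evalG d Λ P N L = 0 ∨ evalG d Λ Q N L ≠ 0) : Q ∈ domN d Λ N P := by
  refine ⟨⟨hQ, hQ0⟩, ?_, hPQ⟩
  rintro rfl
  refine hP0 (congrArg Subtype.val
    ((injective_iff_map_eq_zero _).1 (gridEval_injective h0 hΛ hN) ⟨P, hP⟩ ?_))
  ext L
  exact (hPQ L).resolve_right fun h => h (by simp [evalG, eval])

theorem exists_minimizer_JN (h0 : (0 : Fin d → ℤ) ∈ Λ) (hΛ : ∀ k ∈ Λ, -k ∈ Λ)
    (hN : ∀ k ∈ Λ, ∀ j, 2 * k j < (N j : ℤ)) {c P : (Fin d → ℤ) → ℂ} (hc : c ∈ CplusN d Λ N)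
    (hP : P ∈ PbarN d Λ N) (hP0 : P ≠ 0) :
    ∃ Q ∈ domN d Λ N P, ∀ R ∈ domN d Λ N P, JN d Λ N c P Q ≤ JN d Λ N c P R := by
  have hn := prod_grid_pos h0 hN
  obtain ⟨v, hv, hpv, hmin⟩ := exists_barrier_minimizer (gridEval d Λ N)
    (gridEval_injective h0 hΛ hN) (pairing d Λ c)
    (fun v hv hv0 => hc.2 v ⟨v.2, hv⟩ fun h => hv0 (Subtype.ext h))
    (fun L => (∏ j, (N j : ℝ))⁻¹ * evalG d Λ P N L)
    (fun L => mul_nonneg (inv_nonneg.2 hn.le) (hP.2 L))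
    ⟨Pi.single 0 1, isCoeff_one h0⟩ (fun L => zero_lt_one.trans_eq (evalG_one h0 L).symm)
  refine ⟨v, mem_domN_of_isCoeff h0 hΛ hN hP.1 hP0 v.2 hv fun L => (hpv L).imp_left fun h =>
    (mul_eq_zero.1 h).resolve_left (inv_ne_zero hn.ne'), fun R hR => ?_⟩
  rw [JN_eq, JN_eq]
  exact hmin ⟨R, hR.1.1⟩ hR.1.2 fun L => (hR.2.2 L).imp_left fun h => by rw [h, mul_zero]

theorem exists_multiplier_JN (h0 : (0 : Fin d → ℤ) ∈ Λ) (hΛ : ∀ k ∈ Λ, -k ∈ Λ)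
    (hN : ∀ k ∈ Λ, ∀ j, 2 * k j < (N j : ℤ)) {c P Q : (Fin d → ℤ) → ℂ}
    (hP : P ∈ PbarN d Λ N) (hP0 : P ≠ 0) (hQ : Q ∈ domN d Λ N P)
    (hmin : ∀ R ∈ domN d Λ N P, JN d Λ N c P Q ≤ JN d Λ N c P R) :
    ∃ μ : ((j : Fin d) → Fin (N j)) → ℝ, (∀ L, 0 ≤ μ L) ∧
      (∀ L, μ L ≠ 0 → evalG d Λ Q N L = 0) ∧
      (∃ S : Finset ((j : Fin d) → Fin (N j)), S.card ≤ Λ.card - 1 ∧ ∀ L ∉ S, μ L = 0) ∧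
      ∀ q, IsCoeff d Λ q → pair d Λ c q = (∏ j, (N j : ℝ))⁻¹ *
        ∑ L, (evalG d Λ P N L / evalG d Λ Q N L + μ L) * evalG d Λ q N L := by
  have hn := prod_grid_pos h0 hN
  obtain ⟨μ, hμ, hsupp, ⟨S, hS, hμS⟩, hrep⟩ := exists_barrier_multiplier (gridEval d Λ N)
    (gridEval_injective h0 hΛ hN) (pairing d Λ c)
    (fun L => (∏ j, (N j : ℝ))⁻¹ * evalG d Λ P N L)
    (fun L => mul_nonneg (inv_nonneg.2 hn.le) (hP.2 L)) ⟨Q, hQ.1.1⟩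
    (fun h => hQ.2.1 (congrArg Subtype.val h)) hQ.1.2
    (fun L => (hQ.2.2 L).imp_left fun h => by rw [h, mul_zero]) (fun w hw hpw => by
      have := hmin w (mem_domN_of_isCoeff h0 hΛ hN hP.1 hP0 w.2 hw fun L =>
        (hpw L).imp_left fun h => (mul_eq_zero.1 h).resolve_left (inv_ne_zero hn.ne'))
      rwa [JN_eq, JN_eq] at this)
  refine ⟨fun L => (∏ j, (N j : ℝ)) * μ L, fun L => mul_nonneg hn.le (hμ L),
    fun L hL => hsupp L (right_ne_zero_of_mul hL), ⟨S, ?_, fun L hL => ?_⟩, fun q hq => ?_⟩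
  · have := finrank_coeffs_le hΛ
    omega
  · simp [hμS L hL]
  · refine (hrep ⟨q, hq⟩).trans ?_
    rw [Finset.mul_sum]
    refine Finset.sum_congr rfl fun L _ => ?_
    change (_ * _ / evalG d Λ Q N L + _) * evalG d Λ q N L = _
    field_simp

/-- Two positive polynomials representing the same functional with the same numerator agree. -/
theorem eq_of_pair_eq (h0 : (0 : Fin d → ℤ) ∈ Λ) (hΛ : ∀ k ∈ Λ, -k ∈ Λ)
    (hN : ∀ k ∈ Λ, ∀ j, 2 * k j < (N j : ℤ)) {c P Q R : (Fin d → ℤ) → ℂ}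
    (hP : P ∈ PplusN d Λ N) (hQ : Q ∈ PplusN d Λ N) (hR : R ∈ PplusN d Λ N)
    (hcQ : ∀ q, IsCoeff d Λ q → pair d Λ c q = (∏ j, (N j : ℝ))⁻¹ *
        ∑ L, evalG d Λ P N L / evalG d Λ Q N L * evalG d Λ q N L)
    (hcR : ∀ q, IsCoeff d Λ q → pair d Λ c q = (∏ j, (N j : ℝ))⁻¹ *
        ∑ L, evalG d Λ P N L / evalG d Λ R N L * evalG d Λ q N L) : Q = R := by
  have hn := prod_grid_pos h0 hN
  have hsum : ∀ q, IsCoeff d Λ q →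
      ∑ L, evalG d Λ P N L / evalG d Λ Q N L * evalG d Λ q N L =
        ∑ L, evalG d Λ P N L / evalG d Λ R N L * evalG d Λ q N L := fun q hq =>
    mul_left_cancel₀ (inv_ne_zero hn.ne') ((hcQ q hq).symm.trans (hcR q hq))
  have hterm : ∀ L, evalG d Λ P N L * (evalG d Λ Q N L - evalG d Λ R N L) ^ 2 /
        (evalG d Λ Q N L * evalG d Λ R N L) =
      (evalG d Λ P N L / evalG d Λ R N L * evalG d Λ Q N L
        - evalG d Λ P N L / evalG d Λ Q N L * evalG d Λ Q N L)
      + (evalG d Λ P N L / evalG d Λ Q N L * evalG d Λ R N L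
        - evalG d Λ P N L / evalG d Λ R N L * evalG d Λ R N L) := by
    intro L
    have := (hQ.2 L).ne'
    have := (hR.2 L).ne'
    field_simp
    ring
  have hzero : ∑ L, evalG d Λ P N L * (evalG d Λ Q N L - evalG d Λ R N L) ^ 2 /
      (evalG d Λ Q N L * evalG d Λ R N L) = 0 := by
    simp only [hterm, Finset.sum_add_distrib, Finset.sum_sub_distrib, hsum Q hQ.1, hsum R hR.1,
      sub_self, add_zero]
  have hall := (Finset.sum_eq_zero_iff_of_nonneg fun L _ => div_nonneg
    (mul_nonneg (hP.2 L).le (sq_nonneg _)) (mul_pos (hQ.2 L) (hR.2 L)).le).1 hzero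
  have heq : gridEval d Λ N ⟨Q, hQ.1⟩ = gridEval d Λ N ⟨R, hR.1⟩ := by
    ext L
    have := hall L (Finset.mem_univ L)
    change evalG d Λ Q N L = evalG d Λ R N L
    simpa [(hP.2 L).ne', (hQ.2 L).ne', (hR.2 L).ne', sub_eq_zero] using this
  exact congrArg Subtype.val (gridEval_injective h0 hΛ hN heq)

end TrigPoly

/-- circulant rational covariance extension: if 2nⱼ < Nⱼ, c ∈ ℭ₊(N) and
P ∈ 𝔓̄₊(N) \ {0}, then J_P^N has a minimizer Q̂ over 𝔓̄₊(N) (equivalently, over its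
effective domain), and there is a nonnegative function μ̂ on the grid, supported where
Q̂(ζ_ℓ) = 0 and nonzero in at most |Λ| − 1 points, such that c is matched by
P/Q̂ + μ̂; if moreover P ∈ 𝔓₊(N), then Q̂ ∈ 𝔓₊(N) is the unique minimizer and
Φ = P/Q̂ matches c with μ̂ ≡ 0. -/
theorem statement4 (d : ℕ) (hd : 1 ≤ d) (Λ : Finset (Fin d → ℤ))
    (h0 : (0 : Fin d → ℤ) ∈ Λ) (hΛ : ∀ k ∈ Λ, -k ∈ Λ)
    (N : Fin d → ℕ) (hN : ∀ k ∈ Λ, ∀ j, 2 * k j < (N j : ℤ))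
    (c P : (Fin d → ℤ) → ℂ) (hc : c ∈ CplusN d Λ N)
    (hP : P ∈ PbarN d Λ N) (hP0 : P ≠ 0) :
    (∃ Qhat ∈ domN d Λ N P,
      (∀ Q ∈ domN d Λ N P, JN d Λ N c P Qhat ≤ JN d Λ N c P Q) ∧
      ∃ μhat : ((j : Fin d) → Fin (N j)) → ℝ,
        (∀ L, 0 ≤ μhat L) ∧
        (∀ L, μhat L ≠ 0 → evalG d Λ Qhat N L = 0) ∧
        (∃ S : Finset ((j : Fin d) → Fin (N j)),
          S.card ≤ Λ.card - 1 ∧ ∀ L ∉ S, μhat L = 0) ∧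
        ∀ k ∈ Λ, c k = (∏ j, (N j : ℂ))⁻¹ *
          ∑ L : (j : Fin d) → Fin (N j),
            Complex.exp ((dotP d k (gridθ d N L) : ℂ) * Complex.I) *
              (((if evalG d Λ P N L = 0 then (0 : ℝ)
                 else evalG d Λ P N L / evalG d Λ Qhat N L) : ℂ) + (μhat L : ℂ))) ∧
    (P ∈ PplusN d Λ N →
      ∃ Qhat : (Fin d → ℤ) → ℂ,
        (Qhat ∈ PplusN d Λ N ∧
          (∀ Q ∈ domN d Λ N P, JN d Λ N c P Qhat ≤ JN d Λ N c P Q) ∧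
          ∀ k ∈ Λ, c k = (∏ j, (N j : ℂ))⁻¹ *
            ∑ L : (j : Fin d) → Fin (N j),
              Complex.exp ((dotP d k (gridθ d N L) : ℂ) * Complex.I) *
                ((evalG d Λ P N L / evalG d Λ Qhat N L : ℝ) : ℂ)) ∧
        ∀ Q' : (Fin d → ℤ) → ℂ,
          Q' ∈ PplusN d Λ N →
          (∀ Q ∈ domN d Λ N P, JN d Λ N c P Q' ≤ JN d Λ N c P Q) → Q' = Qhat) := by
  have hmultP : P ∈ PplusN d Λ N → ∀ Q ∈ PplusN d Λ N,
      (∀ R ∈ domN d Λ N P, JN d Λ N c P Q ≤ JN d Λ N c P R) →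
      ∀ q, IsCoeff d Λ q → pair d Λ c q = (∏ j, (N j : ℝ))⁻¹ *
        ∑ L, evalG d Λ P N L / evalG d Λ Q N L * evalG d Λ q N L := by
    intro _ Q hQ hmin q hq
    obtain ⟨μ, _, hsupp, _, hrep⟩ := exists_multiplier_JN h0 hΛ hN hP hP0
      (mem_domN_of_isCoeff h0 hΛ hN hP.1 hP0 hQ.1 (fun L => (hQ.2 L).le)
        fun L => Or.inr (hQ.2 L).ne') hmin
    have hμ : ∀ L, μ L = 0 := fun L => by_contra fun h => (hQ.2 L).ne' (hsupp L h)
    simpa [hμ] using hrep q hq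
  obtain ⟨Qhat, hQ, hmin⟩ := exists_minimizer_JN h0 hΛ hN hc hP hP0
  refine ⟨⟨Qhat, hQ, hmin, ?_⟩, fun hPplus => ?_⟩
  · obtain ⟨μ, hμ, hsupp, hS, hrep⟩ := exists_multiplier_JN h0 hΛ hN hP hP0 hQ hmin
    refine ⟨μ, hμ, hsupp, hS, fun k hk => ?_⟩
    rw [eq_sum_grid_of_pair_eq hΛ hc.1 _ hrep k hk]
    congr 1
    refine Finset.sum_congr rfl fun L _ => ?_
    split_ifs with h <;> simp [h]
  · have hQplus : Qhat ∈ PplusN d Λ N := ⟨hQ.1.1, fun L => lt_of_le_of_ne (hQ.1.2 L)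
      ((hQ.2.2 L).resolve_left (hPplus.2 L).ne').symm⟩
    have hrep := hmultP hPplus Qhat hQplus hmin
    exact ⟨Qhat, ⟨hQplus, hmin, eq_sum_grid_of_pair_eq hΛ hc.1 _ hrep⟩, fun Q' hQ' hmin' =>
      eq_of_pair_eq h0 hΛ hN hPplus hQ' hQplus (hmultP hPplus Q' hQ' hmin') hrep⟩

end RCE
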